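/- arXiv:2308.04331 — 9 statements merged into one kernel-verified Lean document; each statement's English description precedes it below -/
import Mathlib

section
/- Let k ≥ 1 and 1 ≤ ω ≤ k be integers. For each residue i ∈ ℤ/kℤ, let I_i = {i, i+1, …, i+ω−1} (a cyclic interval of length ω in ℤ/kℤ, indices taken modulo k). Then for every nonempty set S ⊆ ℤ/kℤ of cardinality m, the union ⋃_{i∈S} I_i has cardinality at least min(m + ω − 1, k). -/
theorem cyc_aux (k : ℕ) (hk : 1 ≤ k) (S : Finset (ZMod k)) (hS : S.Nonempty) (w : ℕ) :
    min (S.card + w) k ≤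
      (S.biUnion fun i => (Finset.range (w + 1)).image (fun t : ℕ => i + (t : ZMod k))).card := by
  haveI : NeZero k := ⟨by omega⟩
  induction w with
  | zero => simp
  | succ w ih =>
    set U := S.biUnion fun i => (Finset.range (w + 1)).image (fun t : ℕ => i + (t : ZMod k)) with hU
    set V := S.biUnion fun i => (Finset.range (w + 1 + 1)).image (fun t : ℕ => i + (t : ZMod k))
      with hV
    have hUV : U ⊆ V := by
      intro x hx
      simp only [hU, hV, Finset.mem_biUnion, Finset.mem_image, Finset.mem_range] at hx ⊢
      obtain ⟨i, hi, t, ht, rfl⟩ := hx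
      exact ⟨i, hi, t, by omega, rfl⟩
    have hsucc : ∀ x ∈ U, x + 1 ∈ V := by
      intro x hx
      simp only [hU, hV, Finset.mem_biUnion, Finset.mem_image, Finset.mem_range] at hx ⊢
      obtain ⟨i, hi, t, ht, rfl⟩ := hx
      exact ⟨i, hi, t + 1, by omega, by push_cast; ring⟩
    by_cases h : V.card ≤ U.card
    · have hEq : U = V := Finset.eq_of_subset_of_card_le hUV h
      obtain ⟨s, hs⟩ := hS
      have hsU : s ∈ U := by
        simp only [hU, Finset.mem_biUnion, Finset.mem_image, Finset.mem_range]
        exact ⟨s, hs, 0, by omega, by simp⟩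
      have hall : ∀ n : ℕ, s + (n : ZMod k) ∈ U := by
        intro n
        induction n with
        | zero => simpa using hsU
        | succ n ihn =>
          have := hsucc _ ihn
          rw [← hEq] at this
          push_cast
          rwa [← add_assoc]
      have huniv : V = Finset.univ := by
        rw [← hEq, Finset.eq_univ_iff_forall]
        intro x
        have := hall (x - s).val
        rw [ZMod.natCast_zmod_val] at this
        simpa using this
      rw [huniv, Finset.card_univ, ZMod.card]
      exact min_le_right _ _
    · omega

/-- the union of the cyclic intervals `I_i = {i, i+1, …, i+ω−1} ⊆ ℤ/kℤ`
over a nonempty set `S` of `m` starting points has cardinality at least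
`min (m + ω − 1) k`. -/
theorem cyclic_intervals_union_card (k ω : ℕ) (hk : 1 ≤ k) (hω : 1 ≤ ω) (hωk : ω ≤ k)
    (I : ZMod k → Finset (ZMod k))
    (hI : ∀ i : ZMod k, I i = (Finset.range ω).image (fun t : ℕ => i + (t : ZMod k)))
    (S : Finset (ZMod k)) (hS : S.Nonempty) :
    min (S.card + ω - 1) k ≤ (S.biUnion I).card := by
  obtain ⟨w, rfl⟩ : ∃ w, ω = w + 1 := ⟨ω - 1, by omega⟩
  obtain rfl : I = _ := funext hI
  exact cyc_aux k hk S hS w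
end

section
/- Let k ≥ s ≥ 1 be integers with ω = ⌈k(s+1)/(k+s)⌉ ≤ k. For 0 ≤ i < s define the block B_i = {(iω + t) mod k : 0 ≤ t ≤ ω−1} ⊆ ℤ/kℤ, and for j ∈ ℤ/kℤ let v_j = #{i : 0 ≤ i < s, j ∈ B_i}. Then Σ_{j∈ℤ/kℤ} v_j = s·ω, |v_j − v_{j'}| ≤ 1 for all j, j' ∈ ℤ/kℤ, and v_j ≥ ⌊sω/k⌋ for every j ∈ ℤ/kℤ. -/
lemma block_count_aux (k ω : ℕ) [NeZero k] (hωk : ω ≤ k) (j : ZMod k) (a : ℕ) :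
    Nat.count (fun t => ((a + t : ℕ) : ZMod k) = j) ω =
      if j ∈ (Finset.range ω).image (fun t => ((a + t : ℕ) : ZMod k)) then 1 else 0 := by
  rw [Nat.count_eq_card_filter_range]
  split_ifs with h
  · rw [Finset.mem_image] at h
    obtain ⟨t, ht, rfl⟩ := h
    rw [Finset.card_eq_one]
    refine ⟨t, ?_⟩
    ext u
    simp only [Finset.mem_filter, Finset.mem_range, Finset.mem_singleton] at ht ⊢
    constructor
    · rintro ⟨hu, he⟩
      rw [ZMod.natCast_eq_natCast_iff] at he
      have h2 : u ≡ t [MOD k] := Nat.ModEq.add_left_cancel' a he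
      exact Nat.ModEq.eq_of_lt_of_lt h2 (by omega) (by omega)
    · rintro rfl
      exact ⟨ht, rfl⟩
  · rw [Finset.card_eq_zero, Finset.filter_eq_empty_iff]
    intro t ht he
    exact h (Finset.mem_image.2 ⟨t, ht, he⟩)

lemma block_count (k ω : ℕ) [NeZero k] (hωk : ω ≤ k) (j : ZMod k) (s : ℕ) :
    (∑ i ∈ Finset.range s,
      if j ∈ (Finset.range ω).image (fun t => ((i * ω + t : ℕ) : ZMod k)) then 1 else 0) =
    Nat.count (fun n => ((n : ℕ) : ZMod k) = j) (s * ω) := by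
  induction s with
  | zero => simp
  | succ m ih =>
    rw [Finset.sum_range_succ, ih, Nat.succ_mul, Nat.count_add, block_count_aux k ω hωk]

/-- for the blocks `B_i = {iω, iω+1, …, (i+1)ω−1} ⊆ ℤ/kℤ`, `0 ≤ i < s`,
with `ω = ⌈k(s+1)/(k+s)⌉ ≤ k`, the multiplicities `v_j = #{i : j ∈ B_i}` satisfy
`Σ_j v_j = s·ω`, `|v_j − v_{j'}| ≤ 1`, and `v_j ≥ ⌊sω/k⌋`. -/
theorem block_multiplicities (s k ω : ℕ) [NeZero k] (hs : 1 ≤ s) (hsk : s ≤ k)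
    (hω : (ω : ℤ) = ⌈((k : ℚ) * (s + 1)) / (k + s)⌉) (hωk : ω ≤ k)
    (B : Fin s → Finset (ZMod k))
    (hB : ∀ i : Fin s,
      B i = (Finset.range ω).image (fun t => (((i : ℕ) * ω + t : ℕ) : ZMod k)))
    (v : ZMod k → ℕ)
    (hv : ∀ j : ZMod k, v j = (Finset.univ.filter (fun i : Fin s => j ∈ B i)).card) :
    (∑ j : ZMod k, v j) = s * ω ∧
      (∀ j j' : ZMod k, |(v j : ℤ) - (v j' : ℤ)| ≤ 1) ∧
      (∀ j : ZMod k, s * ω / k ≤ v j) := by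
  have key : ∀ j, v j = Nat.count (fun n => ((n : ℕ) : ZMod k) = j) (s * ω) := by
    intro j
    rw [hv, Finset.card_filter, ← block_count k ω hωk j s, Finset.sum_range]
    refine Finset.sum_congr rfl fun i _ => ?_
    rw [hB]
  have hk : 0 < k := Nat.pos_of_ne_zero (NeZero.ne k)
  have key2 : ∀ j, v j = s * ω / k + if j.val % k < (s * ω) % k then 1 else 0 := by
    intro j
    rw [key, ← Nat.count_modEq_card _ hk]
    congr 1
    ext n
    rw [← ZMod.natCast_eq_natCast_iff, ZMod.natCast_zmod_val]
  refine ⟨?_, ?_, ?_⟩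
  · simp only [key, Nat.count_eq_card_filter_range]
    rw [← Finset.card_eq_sum_card_fiberwise (fun _ _ => Finset.mem_coe.2 (Finset.mem_univ _))]
    simp
  · intro j j'
    rw [key2, key2, abs_le]
    split_ifs <;> constructor <;> push_cast <;> linarith
  · intro j
    rw [key2]
    exact Nat.le_add_right _ _
end

section
/- Let k ≥ s ≥ 1 be integers, set ω = ⌈k(s+1)/(k+s)⌉, and for 0 ≤ i < s define the block B_i = {(iω + t) mod k : 0 ≤ t ≤ ω−1} ⊆ ℤ/kℤ. Then for every subset S ⊆ {0, 1, …, s−1} with |S| ≥ ω, the union ⋃_{i∈S} B_i equals all of ℤ/kℤ. -/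
/-- any `ω` (or more) of the blocks `B_0, …, B_{s−1}` cover all of
`ℤ/kℤ`, where `B_i = {iω, iω+1, …, (i+1)ω−1}` and `ω = ⌈k(s+1)/(k+s)⌉`. -/
theorem blocks_cover (s k ω : ℕ) [NeZero k] (hs : 1 ≤ s) (hsk : s ≤ k)
    (hω : (ω : ℤ) = ⌈((k : ℚ) * (s + 1)) / (k + s)⌉)
    (B : Fin s → Finset (ZMod k))
    (hB : ∀ i : Fin s,
      B i = (Finset.range ω).image (fun t => (((i : ℕ) * ω + t : ℕ) : ZMod k)))
    (S : Finset (Fin s)) (hS : ω ≤ S.card) :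
    S.biUnion B = Finset.univ := by
  have hkpos : 0 < k := by omega
  have hden : (0 : ℚ) < (k : ℚ) + s := by positivity
  have h1 : k * (s + 1) ≤ ω * (k + s) := by
    have h := Int.le_ceil (((k : ℚ) * (s + 1)) / (k + s))
    rw [← hω, div_le_iff₀ hden] at h
    exact_mod_cast h
  have h2 : ω ≤ k := by
    have h : ⌈((k : ℚ) * (s + 1)) / (k + s)⌉ ≤ (k : ℤ) := by
      rw [Int.ceil_le, div_le_iff₀ hden]
      have : k * (s + 1) ≤ k * (k + s) := Nat.mul_le_mul_left _ (by omega)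
      exact_mod_cast this
    rw [← hω] at h
    exact_mod_cast h
  have h0 : 0 < ω := by
    rcases Nat.eq_zero_or_pos ω with h | h
    · subst h
      have : 0 < k * (s + 1) := by positivity
      omega
    · exact h
  have hcard : S.card ≤ s := by simpa using Finset.card_le_univ S
  obtain ⟨d, hd⟩ := Nat.exists_eq_add_of_le (hS.trans hcard)
  have h3 : k * (d + 1) ≤ s * ω := by
    have e1 : k * (s + 1) = k * (d + 1) + ω * k := by rw [hd]; ring
    have e2 : ω * (k + s) = s * ω + ω * k := by ring
    omega
  ext x
  simp only [Finset.mem_univ, iff_true, Finset.mem_biUnion]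
  by_contra hx
  have hv : x.val < k := ZMod.val_lt x
  have hpos : ∀ j : Fin (d + 1), (x.val + j * k) / ω < s := by
    intro j
    rw [Nat.div_lt_iff_lt_mul h0]
    have : k * ((j : ℕ) + 1) ≤ k * (d + 1) := Nat.mul_le_mul_left _ j.2
    nlinarith
  let f : Fin (d + 1) → Fin s := fun j => ⟨(x.val + j * k) / ω, hpos j⟩
  have hf : StrictMono f := by
    intro a b hab
    show (x.val + a * k) / ω < (x.val + b * k) / ω
    have hab' : (a : ℕ) + 1 ≤ b := hab
    have hm : ((a : ℕ) + 1) * k ≤ b * k := Nat.mul_le_mul_right _ hab'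
    calc (x.val + a * k) / ω < (x.val + a * k) / ω + 1 := Nat.lt_succ_self _
      _ = (x.val + a * k + ω) / ω := (Nat.add_div_right _ h0).symm
      _ ≤ _ := Nat.div_le_div_right (by nlinarith)
  have hmem : ∀ j, x ∈ B (f j) := by
    intro j
    rw [hB, Finset.mem_image]
    refine ⟨(x.val + j * k) % ω, Finset.mem_range.2 (Nat.mod_lt _ h0), ?_⟩
    show (((x.val + j * k) / ω * ω + (x.val + j * k) % ω : ℕ) : ZMod k) = x
    rw [Nat.div_add_mod']
    simp
  have hsub : Finset.univ.image f ⊆ Sᶜ := by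
    intro i hi
    obtain ⟨j, -, rfl⟩ := Finset.mem_image.1 hi
    exact Finset.mem_compl.2 fun h => hx ⟨_, h, hmem j⟩
  have hc := Finset.card_le_card hsub
  rw [Finset.card_image_of_injective _ hf.injective, Finset.card_compl] at hc
  simp only [Finset.card_univ, Fintype.card_fin] at hc
  omega
end

section
/- Fix integers s ≥ 1 and k ≥ s; set n = k + s and ω = ⌈k(s+1)/n⌉. For 0 ≤ i < n define T_i ⊆ ℤ/kℤ by T_i = {(i + t) mod k : 0 ≤ t ≤ ω−1} if 0 ≤ i < k, and T_i = {(iω + t) mod k : 0 ≤ t ≤ ω−1} if k ≤ i < n. Then for every subset S ⊆ {0, 1, …, n−1} with |S| = m ≤ k, the union ⋃_{i∈S} T_i has cardinality at least m. -/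
theorem aux_closed_univ (k : ℕ) [NeZero k] (A : Finset (ZMod k)) (hA : A.Nonempty)
    (h : ∀ a ∈ A, a + 1 ∈ A) (x : ZMod k) : x ∈ A := by
  obtain ⟨a, ha⟩ := hA
  have h1 : ∀ j : ℕ, a + (j : ZMod k) ∈ A := by
    intro j
    induction j with
    | zero => simpa using ha
    | succ j ih =>
      have := h _ ih
      push_cast
      rwa [← add_assoc]
  have h2 := h1 (x - a).val
  rw [ZMod.natCast_zmod_val] at h2
  simpa using h2

theorem aux_sumset (k : ℕ) [NeZero k] (U : Finset (ZMod k)) (x : ZMod k) (hx : x ∉ U) (t : ℕ) :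
    ∀ A : Finset (ZMod k), A.Nonempty →
      (∀ a ∈ A, ∀ i : ℕ, i ≤ t → a + (i : ZMod k) ∈ U) → A.card + t ≤ U.card := by
  induction t with
  | zero =>
    intro A _ h
    refine Finset.card_le_card fun a ha => ?_
    simpa using h a ha 0 le_rfl
  | succ t ih =>
    intro A hA h
    have hAU : ∀ a ∈ A, a ∈ U := fun a ha => by simpa using h a ha 0 (Nat.zero_le _)
    have hex : ∃ a ∈ A, a + 1 ∉ A := by
      by_contra hcon
      push Not at hcon
      exact hx (hAU x (aux_closed_univ k A hA hcon x))
    obtain ⟨b, hb, hb1⟩ := hex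
    have := ih (insert (b + 1) A) (Finset.insert_nonempty _ _) (by
      intro a ha i hi
      rcases Finset.mem_insert.1 ha with rfl | ha
      · have := h b hb (i + 1) (by omega)
        push_cast at this
        rwa [add_assoc, add_comm 1]
      · exact h a ha i (by omega))
    rw [Finset.card_insert_of_notMem hb1] at this
    omega

/-- Lemma 1: for the support assignment of Algorithm 1, any `m ≤ k`
workers together involve at least `m` distinct uncoded submatrices. -/
theorem alg1_hall_condition (s k n ω : ℕ) (hs : 1 ≤ s) (hsk : s ≤ k) (hn : n = k + s)
    (hω : (ω : ℤ) = ⌈((k : ℚ) * (s + 1)) / n⌉)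
    (T : Fin n → Finset (ZMod k))
    (hT : ∀ i : Fin n, T i =
      if (i : ℕ) < k then
        (Finset.range ω).image (fun t => (((i : ℕ) + t : ℕ) : ZMod k))
      else
        (Finset.range ω).image (fun t => (((i : ℕ) * ω + t : ℕ) : ZMod k)))
    (S : Finset (Fin n)) (hS : S.card ≤ k) :
    S.card ≤ (S.biUnion T).card := by
  have hk : 0 < k := by omega
  have : NeZero k := ⟨hk.ne'⟩
  have hnpos : (0 : ℚ) < n := by
    have : 0 < n := by omega
    exact_mod_cast this
  -- arithmetic facts on ω
  have hlow : k * (s + 1) ≤ ω * (k + s) := by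
    have h1 := Int.le_ceil (((k : ℚ) * (s + 1)) / n)
    rw [← hω, div_le_iff₀ hnpos, hn] at h1
    exact_mod_cast h1
  have hωk : ω ≤ k := by
    have h1 : ⌈((k : ℚ) * (s + 1)) / n⌉ ≤ (k : ℤ) := by
      rw [Int.ceil_le, div_le_iff₀ hnpos, hn]
      have : k * (s + 1) ≤ k * (k + s) := Nat.mul_le_mul_left _ (by omega)
      exact_mod_cast this
    rw [← hω] at h1
    exact_mod_cast h1
  have hω0 : 0 < ω := by
    rcases Nat.eq_zero_or_pos ω with h | h
    · rw [h] at hlow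
      have : 0 < k * (s + 1) := by positivity
      omega
    · exact h
  set U := S.biUnion T with hU
  by_cases hall : ∀ x, x ∈ U
  · have : U = Finset.univ := Finset.eq_univ_iff_forall.2 hall
    rw [this, Finset.card_univ, ZMod.card]
    exact hS
  push Not at hall
  obtain ⟨x, hx⟩ := hall
  have hsplit := Finset.card_filter_add_card_filter_not (s := S) (fun i : Fin n => (i : ℕ) < k)
  set A := S.filter (fun i : Fin n => (i : ℕ) < k) with hAdef
  set B := S.filter (fun i : Fin n => ¬ (i : ℕ) < k) with hBdef
  -- bound on B
  have hB : B.card + (s + 1 - ω) ≤ s := by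
    let f : ℕ → ℕ := fun q => k + (x.val + q * k) / ω
    have hf : StrictMono f := by
      refine strictMono_nat_of_lt_succ fun q => ?_
      have h1 : (x.val + q * k + ω) / ω = (x.val + q * k) / ω + 1 := Nat.add_div_right _ hω0
      have h2 : (x.val + q * k + ω) / ω ≤ (x.val + (q + 1) * k) / ω :=
        Nat.div_le_div_right (by rw [add_mul]; omega)
      simp only [f]
      omega
    let C := (Finset.range (s + 1 - ω)).image f
    have hC : C.card = s + 1 - ω := by
      rw [Finset.card_image_of_injective _ hf.injective, Finset.card_range]
    let B' := B.image (fun i : Fin n => (i : ℕ))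
    have hB' : B'.card = B.card := Finset.card_image_of_injective _ Fin.val_injective
    have hdis : Disjoint B' C := by
      rw [Finset.disjoint_left]
      intro y hy hyC
      obtain ⟨i, hi, rfl⟩ := Finset.mem_image.1 hy
      obtain ⟨q, -, hq⟩ := Finset.mem_image.1 hyC
      have hi' := Finset.mem_filter.1 hi
      apply hx
      rw [hU, Finset.mem_biUnion]
      refine ⟨i, hi'.1, ?_⟩
      rw [hT, if_neg hi'.2, Finset.mem_image]
      refine ⟨(x.val + q * k) % ω, Finset.mem_range.2 (Nat.mod_lt _ hω0), ?_⟩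
      rw [← hq]
      have h3 : (k + (x.val + q * k) / ω) * ω + (x.val + q * k) % ω
          = k * ω + (x.val + q * k) := by
        have := Nat.div_add_mod (x.val + q * k) ω
        rw [add_mul, mul_comm (_ / ω)]
        omega
      simp only [f]
      rw [h3]
      push_cast
      simp
    have hsub : B' ∪ C ⊆ Finset.Ico k (k + s) := by
      intro y hy
      rw [Finset.mem_Ico]
      rcases Finset.mem_union.1 hy with hy | hy
      · obtain ⟨i, hi, rfl⟩ := Finset.mem_image.1 hy
        have hi' := Finset.mem_filter.1 hi
        have := i.isLt
        omega
      · obtain ⟨q, hq, rfl⟩ := Finset.mem_image.1 hy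
        have hq' := Finset.mem_range.1 hq
        have hxv := ZMod.val_lt x
        have h4 : (x.val + q * k) / ω < s := by
          rw [Nat.div_lt_iff_lt_mul hω0]
          have h5 : (q + 1 + ω) * k ≤ (s + 1) * k := Nat.mul_le_mul_right _ (by omega)
          nlinarith
        exact ⟨Nat.le_add_right _ _, Nat.add_lt_add_left h4 _⟩
    have h6 := Finset.card_le_card hsub
    rw [Finset.card_union_of_disjoint hdis, hC, hB', Nat.card_Ico] at h6
    omega
  rcases A.eq_empty_or_nonempty with hA | hA
  · rw [hA, Finset.card_empty] at hsplit
    rcases B.eq_empty_or_nonempty with hBe | ⟨i, hi⟩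
    · rw [hBe, Finset.card_empty] at hsplit
      omega
    · have hi' := Finset.mem_filter.1 hi
      have := aux_sumset k U x hx (ω - 1) {(((i : ℕ) * ω : ℕ) : ZMod k)}
        (Finset.singleton_nonempty _) (by
          intro a ha t ht
          rw [Finset.mem_singleton.1 ha, hU, Finset.mem_biUnion]
          refine ⟨i, hi'.1, ?_⟩
          rw [hT, if_neg hi'.2, Finset.mem_image]
          exact ⟨t, Finset.mem_range.2 (by omega), by push_cast; rfl⟩)
      omega
  · have hcard : (A.image (fun i : Fin n => ((i : ℕ) : ZMod k))).card = A.card := by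
      apply Finset.card_image_of_injOn
      intro i hi j hj hij
      have hi' := (Finset.mem_filter.1 hi).2
      have hj' := (Finset.mem_filter.1 hj).2
      have h7 := congrArg ZMod.val hij
      simp only [ZMod.val_natCast] at h7
      rw [Nat.mod_eq_of_lt hi', Nat.mod_eq_of_lt hj'] at h7
      exact Fin.ext h7
    have := aux_sumset k U x hx (ω - 1) (A.image (fun i : Fin n => ((i : ℕ) : ZMod k)))
      (hA.image _) (by
        intro a ha t ht
        obtain ⟨i, hi, rfl⟩ := Finset.mem_image.1 ha
        have hi' := Finset.mem_filter.1 hi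
        rw [hU, Finset.mem_biUnion]
        refine ⟨i, hi'.1, ?_⟩
        rw [hT, if_pos hi'.2, Finset.mem_image]
        exact ⟨t, Finset.mem_range.2 (by omega), by push_cast; rfl⟩)
    omega
end

section
/- Fix integers s ≥ 1 and k ≥ s; set n = k + s and ω = ⌈k(s+1)/n⌉. For 0 ≤ i < n define T_i ⊆ ℤ/kℤ by T_i = {(i + t) mod k : 0 ≤ t ≤ ω−1} if 0 ≤ i < k, and T_i = {(iω + t) mod k : 0 ≤ t ≤ ω−1} if k ≤ i < n. Then for every subset W ⊆ {0, 1, …, n−1} with |W| = k, there exists an injective function f : W → ℤ/kℤ such that f(i) ∈ T_i for every i ∈ W; that is, the bipartite graph between the workers in W and the k unknowns (where worker i is adjacent to the unknowns indexed by T_i) admits a perfect matching. -/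
theorem alg1_interval_growth (k : ℕ) [NeZero k] (U : Finset (ZMod k)) (x : ZMod k) (hx : x ∉ U)
    (m : ℕ) : ∀ A : Finset (ZMod k), A.Nonempty →
      (∀ a ∈ A, ∀ t : ℕ, t < m + 1 → a + (t : ZMod k) ∈ U) → A.card + m ≤ U.card := by
  induction m with
  | zero =>
    intro A _ h
    have : A ⊆ U := fun a ha => by simpa using h a ha 0 (by omega)
    simpa using Finset.card_le_card this
  | succ m ih =>
    intro A hA h
    have hAU : A ⊆ U := fun a ha => by simpa using h a ha 0 (by omega)
    have hnot : ¬ ∀ a ∈ A, a + 1 ∈ A := by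
      intro hcl
      obtain ⟨a, ha⟩ := hA
      have hall : ∀ t : ℕ, a + (t : ZMod k) ∈ A := by
        intro t
        induction t with
        | zero => simpa using ha
        | succ t iht =>
          have := hcl _ iht
          push_cast
          rwa [← add_assoc]
      have h1 := hall (x - a).val
      rw [ZMod.natCast_zmod_val] at h1
      apply hx
      apply hAU
      simpa using h1
    push Not at hnot
    obtain ⟨a, ha, ha1⟩ := hnot
    have h2 := ih (insert (a + 1) A) (by simp) (by
      intro b hb t ht
      rcases Finset.mem_insert.1 hb with rfl | hb
      · have := h a ha (t + 1) (by omega)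
        push_cast at this
        rwa [add_assoc, add_comm 1]
      · exact h b hb t (by omega))
    rw [Finset.card_insert_of_notMem ha1] at h2
    omega

theorem alg1_tiles_avoid (s k w : ℕ) [NeZero k] (hw : 1 ≤ w) (hwk : w ≤ k)
    (hb : k * (s + 1) ≤ w * (s + k)) (x : ZMod k) (J : Finset ℕ) (hJ : ∀ j ∈ J, j < s)
    (h : ∀ j ∈ J, ∀ t : ℕ, t < w → ((j * w + t : ℕ) : ZMod k) ≠ x) : J.card < w := by
  have hv : x.val < k := ZMod.val_lt x
  have hq : k * (s + 1 - w) ≤ s * w := by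
    rcases le_total (s + 1) w with h1 | h1
    · simp [Nat.sub_eq_zero_of_le h1]
    · obtain ⟨d, hd⟩ := Nat.exists_eq_add_of_le h1
      have : s + 1 - w = d := by omega
      rw [this]
      rw [hd] at hb
      nlinarith
  have hlt : ∀ c, c < s + 1 - w → (x.val + k * c) / w < s := by
    intro c hc
    rw [Nat.div_lt_iff_lt_mul (by omega)]
    have : k * (c + 1) ≤ k * (s + 1 - w) := Nat.mul_le_mul_left _ hc
    nlinarith
  have hmono : StrictMono (fun c => (x.val + k * c) / w) := by
    apply strictMono_nat_of_lt_succ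
    intro c
    have h1 : (x.val + k * c + w) / w ≤ (x.val + k * (c + 1)) / w := by
      apply Nat.div_le_div_right
      nlinarith
    rw [Nat.add_div_right _ (by omega)] at h1
    exact h1
  have hdisj : Disjoint J ((Finset.range (s + 1 - w)).image (fun c => (x.val + k * c) / w)) := by
    rw [Finset.disjoint_left]
    intro j hj hj2
    obtain ⟨c, -, rfl⟩ := Finset.mem_image.1 hj2
    apply h _ hj ((x.val + k * c) % w) (Nat.mod_lt _ (by omega))
    rw [Nat.div_add_mod']
    simp
  have hsub : J ∪ ((Finset.range (s + 1 - w)).image (fun c => (x.val + k * c) / w))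
      ⊆ Finset.range s := by
    intro j hj
    rw [Finset.mem_range]
    rcases Finset.mem_union.1 hj with hj | hj
    · exact hJ j hj
    · obtain ⟨c, hc, rfl⟩ := Finset.mem_image.1 hj
      exact hlt c (Finset.mem_range.1 hc)
  have := Finset.card_le_card hsub
  rw [Finset.card_union_of_disjoint hdisj, Finset.card_image_of_injective _ hmono.injective,
    Finset.card_range, Finset.card_range] at this
  omega

/-- for the support assignment of Algorithm 1, any `k` workers admit
a perfect matching to the `k` unknowns (a system of distinct representatives). -/
theorem alg1_perfect_matching (s k n ω : ℕ) (hs : 1 ≤ s) (hsk : s ≤ k) (hn : n = k + s)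
    (hω : (ω : ℤ) = ⌈((k : ℚ) * (s + 1)) / n⌉)
    (T : Fin n → Finset (ZMod k))
    (hT : ∀ i : Fin n, T i =
      if (i : ℕ) < k then
        (Finset.range ω).image (fun t => (((i : ℕ) + t : ℕ) : ZMod k))
      else
        (Finset.range ω).image (fun t => (((i : ℕ) * ω + t : ℕ) : ZMod k)))
    (W : Finset (Fin n)) (hW : W.card = k) :
    ∃ f : W → ZMod k, Function.Injective f ∧ ∀ i : W, f i ∈ T (i : Fin n) := by
  have hk : 1 ≤ k := hs.trans hsk
  haveI : NeZero k := ⟨by omega⟩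
  have hnpos : (0 : ℚ) < n := by
    have : 0 < n := by omega
    exact_mod_cast this
  have hb : k * (s + 1) ≤ ω * (s + k) := by
    have h1 := Int.le_ceil (((k : ℚ) * (s + 1)) / n)
    rw [← hω, div_le_iff₀ hnpos, hn] at h1
    have h2 : ((k * (s + 1) : ℕ) : ℚ) ≤ ((ω * (k + s) : ℕ) : ℚ) := by
      push_cast at h1 ⊢
      exact h1
    rw [add_comm s k]
    exact_mod_cast h2
  have hw1 : 1 ≤ ω := by
    rcases Nat.eq_zero_or_pos ω with h0 | h0
    · rw [h0] at hb
      nlinarith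
    · exact h0
  have hwk : ω ≤ k := by
    have : (ω : ℤ) ≤ (k : ℤ) := by
      rw [hω, Int.ceil_le, div_le_iff₀ hnpos, hn]
      push_cast
      have h1 : (1 : ℚ) ≤ k := by exact_mod_cast hk
      nlinarith
    exact_mod_cast this
  rw [← Finset.all_card_le_biUnion_card_iff_exists_injective (fun i : W => T (i : Fin n))]
  intro S
  set U := S.biUnion (fun i : W => T (i : Fin n)) with hU
  by_cases huniv : U = Finset.univ
  · rw [huniv, Finset.card_univ, ZMod.card]
    have := Finset.card_le_univ S
    simpa [hW] using this
  obtain ⟨x, hx⟩ : ∃ x, x ∉ U := by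
    by_contra hcon
    push Not at hcon
    exact huniv (Finset.eq_univ_iff_forall.2 hcon)
  have hA : ∀ i ∈ S, ((i : Fin n) : ℕ) < k → ∀ t, t < ω →
      ((((i : Fin n) : ℕ) : ZMod k) + (t : ZMod k)) ∈ U := by
    intro i hi hik t ht
    rw [hU, Finset.mem_biUnion]
    refine ⟨i, hi, ?_⟩
    rw [hT, if_pos hik]
    exact Finset.mem_image.2 ⟨t, Finset.mem_range.2 ht, by push_cast; rfl⟩
  have hB : ∀ i ∈ S, ¬ ((i : Fin n) : ℕ) < k → ∀ t, t < ω →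
      (((((i : Fin n) : ℕ) - k) * ω + t : ℕ) : ZMod k) ∈ U := by
    intro i hi hik t ht
    rw [hU, Finset.mem_biUnion]
    refine ⟨i, hi, ?_⟩
    rw [hT, if_neg hik]
    refine Finset.mem_image.2 ⟨t, Finset.mem_range.2 ht, ?_⟩
    obtain ⟨d, hd⟩ := Nat.exists_eq_add_of_le (not_lt.1 hik)
    rw [hd]
    simp
  have hsplit := Finset.card_filter_add_card_filter_not (s := S)
    (fun i : W => ((i : Fin n) : ℕ) < k)
  -- workers of the second kind
  have hBc : (S.filter (fun i : W => ¬ ((i : Fin n) : ℕ) < k)).card < ω := by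
    rw [← Finset.card_image_of_injOn (f := fun i : W => ((i : Fin n) : ℕ) - k)]
    · apply alg1_tiles_avoid s k ω hw1 hwk hb x
      · intro j hj
        obtain ⟨i, hi, rfl⟩ := Finset.mem_image.1 hj
        have h1 := (i : Fin n).isLt
        have h2 := (Finset.mem_filter.1 hi).2
        show ((i : Fin n) : ℕ) - k < s
        omega
      · intro j hj t ht heq
        obtain ⟨i, hi, rfl⟩ := Finset.mem_image.1 hj
        have h2 := Finset.mem_filter.1 hi
        exact hx (heq ▸ hB i h2.1 h2.2 t ht)
    · intro i hi j hj hij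
      have h1 := (Finset.mem_filter.1 hi).2
      have h2 := (Finset.mem_filter.1 hj).2
      apply Subtype.ext
      apply Fin.ext
      simp only at hij
      omega
  rcases (S.filter (fun i : W => ((i : Fin n) : ℕ) < k)).eq_empty_or_nonempty with he | hne
  · rw [he, Finset.card_empty, zero_add] at hsplit
    rcases S.eq_empty_or_nonempty with hS | ⟨i, hi⟩
    · simp [hS]
    · have hik : ¬ ((i : Fin n) : ℕ) < k := by
        intro hik
        have : i ∈ S.filter (fun i : W => ((i : Fin n) : ℕ) < k) := Finset.mem_filter.2 ⟨hi, hik⟩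
        rw [he] at this
        simp at this
      have := alg1_interval_growth k U x hx (ω - 1)
        {(((((i : Fin n) : ℕ) - k) * ω : ℕ) : ZMod k)} (by simp) (by
          intro a ha t ht
          rw [Finset.mem_singleton.1 ha]
          have := hB i hi hik t (by omega)
          rwa [Nat.cast_add] at this)
      rw [Finset.card_singleton] at this
      omega
  · have := alg1_interval_growth k U x hx (ω - 1)
      ((S.filter (fun i : W => ((i : Fin n) : ℕ) < k)).image
        (fun i : W => (((i : Fin n) : ℕ) : ZMod k))) (hne.image _) (by
          intro a ha t ht
          obtain ⟨i, hi, rfl⟩ := Finset.mem_image.1 ha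
          have h2 := Finset.mem_filter.1 hi
          exact hA i h2.1 h2.2 t (by omega))
    rw [Finset.card_image_of_injOn] at this
    · omega
    · intro i hi j hj hij
      have h1 := (Finset.mem_filter.1 hi).2
      have h2 := (Finset.mem_filter.1 hj).2
      apply Subtype.ext
      apply Fin.ext
      have h3 := congrArg ZMod.val hij
      simp only at h3
      rwa [ZMod.val_natCast_of_lt h1, ZMod.val_natCast_of_lt h2] at h3
end

section
/- Fix integers s ≥ 1 and k ≥ s; set n = k + s and ω = ⌈k(s+1)/n⌉. For 0 ≤ i < n define T_i ⊆ ℤ/kℤ by T_i = {(i + t) mod k : 0 ≤ t ≤ ω−1} if 0 ≤ i < k, and T_i = {(iω + t) mod k : 0 ≤ t ≤ ω−1} if k ≤ i < n. Then for every subset W ⊆ {0, 1, …, n−1} with |W| = k, there exists a real k × k matrix H, with rows indexed by W and columns indexed by ℤ/kℤ, such that H_{i,j} = 0 whenever j ∉ T_i and H is invertible (det H ≠ 0). -/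
theorem aux_succ {k : ℕ} [NeZero k] (B : Finset (ZMod k)) (hB : B.Nonempty)
    (h : ∀ b ∈ B, b + 1 ∈ B) (x : ZMod k) : x ∈ B := by
  obtain ⟨b, hb⟩ := hB
  have h1 : ∀ m : ℕ, b + (m : ZMod k) ∈ B := by
    intro m
    induction m with
    | zero => simpa using hb
    | succ m ih =>
      have := h _ ih
      push_cast
      rwa [← add_assoc]
  have := h1 (x - b).val
  rw [ZMod.natCast_zmod_val] at this
  simpa using this

theorem aux_arc {k : ℕ} [NeZero k] (A : Finset (ZMod k)) (hA : A.Nonempty) (x : ZMod k) (w : ℕ)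
    (hx : x ∉ A.biUnion (fun a => (Finset.range (w + 1)).image (fun t : ℕ => a + (t : ZMod k)))) :
    A.card + w ≤
      (A.biUnion (fun a => (Finset.range (w + 1)).image (fun t : ℕ => a + (t : ZMod k)))).card := by
  induction w with
  | zero =>
    simp
  | succ w ih =>
    set D := A.biUnion (fun a => (Finset.range (w + 1)).image (fun t : ℕ => a + (t : ZMod k))) with hD
    set D' := A.biUnion
      (fun a => (Finset.range (w + 1 + 1)).image (fun t : ℕ => a + (t : ZMod k))) with hD'
    have hsub : D ⊆ D' := by
      intro y hy
      simp only [hD, hD', Finset.mem_biUnion, Finset.mem_image, Finset.mem_range] at hy ⊢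
      obtain ⟨a, ha, t, ht, rfl⟩ := hy
      exact ⟨a, ha, t, by omega, rfl⟩
    have hsucc : ∀ y ∈ D, y + 1 ∈ D' := by
      intro y hy
      simp only [hD, hD', Finset.mem_biUnion, Finset.mem_image, Finset.mem_range] at hy ⊢
      obtain ⟨a, ha, t, ht, rfl⟩ := hy
      exact ⟨a, ha, t + 1, by omega, by push_cast; ring⟩
    have hne : D.Nonempty := by
      obtain ⟨a, ha⟩ := hA
      refine ⟨a, ?_⟩
      simp only [hD, Finset.mem_biUnion, Finset.mem_image, Finset.mem_range]
      exact ⟨a, ha, 0, by omega, by simp⟩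
    have h1 := ih (fun h => hx (hsub h))
    have h2 : D ⊂ D' := by
      refine lt_of_le_of_ne hsub ?_
      intro he
      apply hx
      rw [← he]
      exact aux_succ D hne (fun b hb => he ▸ hsucc b hb) x
    have := Finset.card_lt_card h2
    omega

theorem aux_hall (s k n ω : ℕ) [NeZero k] (hn : n = k + s) (hω1 : 1 ≤ ω) (hωk : ω ≤ k)
    (hω : k * (s + 1) ≤ ω * (k + s))
    (T : Fin n → Finset (ZMod k))
    (hT : ∀ i : Fin n, T i =
      if (i : ℕ) < k then
        (Finset.range ω).image (fun t => (((i : ℕ) + t : ℕ) : ZMod k))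
      else
        (Finset.range ω).image (fun t => (((i : ℕ) * ω + t : ℕ) : ZMod k)))
    (S : Finset (Fin n)) (hS : S.card ≤ k) : S.card ≤ (S.biUnion T).card := by
  classical
  by_cases hx : ∃ x, x ∉ S.biUnion T
  swap
  · push Not at hx
    have : S.biUnion T = Finset.univ := by ext x; simp only [hx x, Finset.mem_univ]
    rw [this, Finset.card_univ, ZMod.card]
    exact hS
  obtain ⟨x, hx⟩ := hx
  obtain ⟨w, rfl⟩ : ∃ w, ω = w + 1 := ⟨ω - 1, by omega⟩
  set ω := w + 1 with hwdef
  have hkpos : 0 < k := by omega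
  have hT1 : ∀ i : Fin n, (i : ℕ) < k → T i =
      (Finset.range ω).image (fun t : ℕ => ((i : ℕ) : ZMod k) + (t : ZMod k)) := by
    intro i hi
    rw [hT, if_pos hi]
    simp
  -- second type
  have h2 : (S.filter (fun i : Fin n => ¬ (i : ℕ) < k)).card ≤ w := by
    set f : ℕ → ℕ := fun m => (x.val + ω * k + m * k) / ω with hf
    have hxv : x.val < k := ZMod.val_lt x
    have hfi : Set.InjOn f (Finset.range (s + 1 - ω) : Set ℕ) := by
      have key : ∀ a b : ℕ, a < b → f a ≠ f b := by
        intro a b hab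
        apply ne_of_lt
        simp only [hf]
        rw [Nat.div_lt_iff_lt_mul (by omega)]
        have h3 : (x.val + ω * k + a * k) + k ≤ x.val + ω * k + b * k := by
          nlinarith
        have h4 := Nat.div_mul_le_self (x.val + ω * k + b * k) ω
        have h5 := Nat.lt_div_mul_add (a := x.val + ω * k + b * k) (b := ω) (by omega)
        omega
      intro a _ b _ hab
      by_contra hne
      rcases lt_or_gt_of_ne hne with h | h
      · exact key a b h hab
      · exact key b a h hab.symm
    have hlo : ∀ m, k ≤ f m := by
      intro m
      simp only [hf]
      rw [Nat.le_div_iff_mul_le (by omega)]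
      nlinarith [Nat.zero_le (m * k)]
    have hhi : ∀ m < s + 1 - ω, f m < n := by
      intro m hm
      simp only [hf]
      rw [Nat.div_lt_iff_lt_mul (by omega), hn]
      have h6 : (m + ω) * k ≤ s * k := Nat.mul_le_mul_right _ (by omega)
      nlinarith
    have hmem : ∀ m (hm : m < s + 1 - ω), x ∈ T ⟨f m, hhi m hm⟩ := by
      intro m hm
      rw [hT, if_neg (by simpa using hlo m)]
      simp only [Finset.mem_image, Finset.mem_range]
      refine ⟨(x.val + ω * k + m * k) % ω, Nat.mod_lt _ (by omega), ?_⟩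
      simp only [hf]
      rw [mul_comm, Nat.div_add_mod]
      simp
    have hdisj : Disjoint ((S.filter (fun i : Fin n => ¬ (i : ℕ) < k)).image (fun i : Fin n => (i : ℕ)))
        ((Finset.range (s + 1 - ω)).image f) := by
      rw [Finset.disjoint_left]
      intro a ha hb
      simp only [Finset.mem_image, Finset.mem_filter, Finset.mem_range] at ha hb
      obtain ⟨i, ⟨hi, _⟩, rfl⟩ := ha
      obtain ⟨m, hm, hmi⟩ := hb
      apply hx
      rw [Finset.mem_biUnion]
      refine ⟨i, hi, ?_⟩
      have : i = ⟨f m, hhi m hm⟩ := Fin.ext hmi.symm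
      rw [this]
      exact hmem m hm
    have hsub : ((S.filter (fun i : Fin n => ¬ (i : ℕ) < k)).image (fun i : Fin n => (i : ℕ))) ∪
        ((Finset.range (s + 1 - ω)).image f) ⊆ Finset.Ico k n := by
      intro a ha
      simp only [Finset.mem_union, Finset.mem_image, Finset.mem_filter, Finset.mem_range] at ha
      rw [Finset.mem_Ico]
      rcases ha with ⟨i, ⟨_, hi⟩, rfl⟩ | ⟨m, hm, rfl⟩
      · exact ⟨by omega, i.2⟩
      · exact ⟨hlo m, hhi m hm⟩
    have hc := Finset.card_le_card hsub
    rw [Finset.card_union_of_disjoint hdisj, Finset.card_image_of_injective _ Fin.val_injective,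
      Finset.card_image_of_injOn hfi, Finset.card_range, Nat.card_Ico] at hc
    omega
  have hsplit := Finset.card_filter_add_card_filter_not (s := S) (fun i : Fin n => (i : ℕ) < k)
  by_cases hne : (S.filter (fun i : Fin n => (i : ℕ) < k)).Nonempty
  · set A := (S.filter (fun i : Fin n => (i : ℕ) < k)).image
      (fun i : Fin n => ((i : ℕ) : ZMod k)) with hA
    have hAc : A.card = (S.filter (fun i : Fin n => (i : ℕ) < k)).card := by
      apply Finset.card_image_of_injOn
      intro a ha b hb hab
      simp only [Finset.coe_filter, Set.mem_ofPred_eq] at ha hb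
      have := congrArg ZMod.val hab
      simp only [ZMod.val_natCast, Nat.mod_eq_of_lt ha.2, Nat.mod_eq_of_lt hb.2] at this
      exact Fin.ext this
    have hsub : A.biUnion (fun a => (Finset.range (w + 1)).image (fun t : ℕ => a + (t : ZMod k)))
        ⊆ S.biUnion T := by
      intro y hy
      rw [Finset.mem_biUnion] at hy ⊢
      obtain ⟨a, ha, hy⟩ := hy
      simp only [hA, Finset.mem_image, Finset.mem_filter] at ha
      obtain ⟨i, ⟨hi, hik⟩, rfl⟩ := ha
      exact ⟨i, hi, by rw [hT1 i hik]; exact hy⟩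
    have h3 := aux_arc A (hne.image _) x w (fun h => hx (hsub h))
    have h4 := Finset.card_le_card hsub
    omega
  · rw [Finset.not_nonempty_iff_eq_empty] at hne
    rw [hne, Finset.card_empty] at hsplit
    rcases S.eq_empty_or_nonempty with rfl | ⟨i, hi⟩
    · simp
    have hik : ¬ (i : ℕ) < k := by
      intro h
      have : i ∈ S.filter (fun i : Fin n => (i : ℕ) < k) := Finset.mem_filter.2 ⟨hi, h⟩
      rw [hne] at this
      simp at this
    have hsub : ({(((i : ℕ) * ω : ℕ) : ZMod k)} : Finset (ZMod k)).biUnion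
        (fun a => (Finset.range (w + 1)).image (fun t : ℕ => a + (t : ZMod k)))
        ⊆ S.biUnion T := by
      intro y hy
      rw [Finset.mem_biUnion]
      refine ⟨i, hi, ?_⟩
      rw [hT, if_neg hik]
      rw [Finset.singleton_biUnion] at hy
      simpa only [Nat.cast_add] using hy
    have h3 := aux_arc _ (Finset.singleton_nonempty _) x w (fun h => hx (hsub h))
    have h4 := Finset.card_le_card hsub
    omega

/-- for the support assignment of Algorithm 1 and any set `W` of `k`
workers, there is a real decoding matrix `H` (rows indexed by `W`, columns by
`ℤ/kℤ`) supported on the pattern `T` that is invertible (nonzero determinant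
after identifying rows with columns via a bijection). -/
theorem alg1_invertible_decoding (s k n ω : ℕ) [NeZero k]
    (hs : 1 ≤ s) (hsk : s ≤ k) (hn : n = k + s)
    (hω : (ω : ℤ) = ⌈((k : ℚ) * (s + 1)) / n⌉)
    (T : Fin n → Finset (ZMod k))
    (hT : ∀ i : Fin n, T i =
      if (i : ℕ) < k then
        (Finset.range ω).image (fun t => (((i : ℕ) + t : ℕ) : ZMod k))
      else
        (Finset.range ω).image (fun t => (((i : ℕ) * ω + t : ℕ) : ZMod k)))
    (W : Finset (Fin n)) (hW : W.card = k) :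
    ∃ (H : Matrix W (ZMod k) ℝ) (e : W ≃ ZMod k),
      (∀ (i : W) (j : ZMod k), j ∉ T (i : Fin n) → H i j = 0) ∧
      (H.submatrix e.symm id).det ≠ 0 := by
  classical
  have hk : 0 < k := by omega
  have hnq : (0 : ℚ) < n := by
    rw [hn]; exact_mod_cast (by omega : 0 < k + s)
  have hω1 : 1 ≤ ω := by
    have : (0 : ℤ) < ω := by
      rw [hω, Int.ceil_pos]
      have : (0 : ℚ) < k := by exact_mod_cast hk
      positivity
    omega
  have hωk : ω ≤ k := by
    have : (ω : ℤ) ≤ k := by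
      rw [hω, Int.ceil_le, div_le_iff₀ hnq]
      rw [hn]
      exact_mod_cast Nat.mul_le_mul_left k (by omega : s + 1 ≤ k + s)
    omega
  have hωm : k * (s + 1) ≤ ω * (k + s) := by
    have h1 : ((k : ℚ) * (s + 1)) / n ≤ ((ω : ℤ) : ℚ) := by
      rw [hω]; exact Int.le_ceil _
    rw [div_le_iff₀ hnq, hn] at h1
    exact_mod_cast h1
  obtain ⟨f, hf, hfT⟩ := (Finset.all_card_le_biUnion_card_iff_exists_injective
    (fun i : W => T (i : Fin n))).1 (by
      intro S
      have h1 := aux_hall s k n ω hn hω1 hωk hωm T hT (S.map (Function.Embedding.subtype _)) (by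
        rw [Finset.card_map, ← hW, ← Fintype.card_coe W]
        exact Finset.card_le_univ S)
      rw [Finset.card_map] at h1
      refine h1.trans (Finset.card_le_card ?_)
      intro y hy
      rw [Finset.mem_biUnion] at hy ⊢
      obtain ⟨a, ha, hy⟩ := hy
      obtain ⟨b, hb, rfl⟩ := Finset.mem_map.1 ha
      exact ⟨b, hb, hy⟩)
  have hb : Function.Bijective f := by
    rw [Fintype.bijective_iff_injective_and_card]
    exact ⟨hf, by rw [Fintype.card_coe, hW, ZMod.card]⟩
  refine ⟨fun i j => if j = f i then 1 else 0, Equiv.ofBijective f hb, ?_, ?_⟩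
  · intro i j hj
    refine if_neg ?_
    rintro rfl
    exact hj (hfT i)
  · have : Matrix.submatrix (fun (i : W) (j : ZMod k) => if j = f i then (1 : ℝ) else 0)
        (Equiv.ofBijective f hb).symm id = 1 := by
      ext i j
      have h2 : f ((Equiv.ofBijective f hb).symm i) = i :=
        (Equiv.ofBijective f hb).apply_symm_apply i
      change (if j = f ((Equiv.ofBijective f hb).symm i) then (1 : ℝ) else 0) = _
      rw [h2, Matrix.one_apply]
      simp only [eq_comm]
    have h3 := congrArg Matrix.det this
    rw [Matrix.det_one] at h3
    exact ne_of_eq_of_ne h3 one_ne_zero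
end

section
/- Let n ≥ 1 and k ≥ 1 be integers, let T_0, …, T_{n−1} be subsets of a set B with k elements, and suppose that for every subset S ⊆ {0, …, n−1} with |S| = m ≤ k the union ⋃_{i∈S} T_i has cardinality at least m. Let x be an element not in B, and define T'_i = T_i ∪ {x} ⊆ B ∪ {x}. Then for every subset S ⊆ {0, …, n−1} with |S| = m ≤ k + 1, the union ⋃_{i∈S} T'_i has cardinality at least m. -/
/-- augmenting every support set by a common new element `x ∉ B`
extends the Hall-type covering condition from threshold `k` to threshold `k+1`. -/
theorem augmented_hall_condition {α : Type*} [DecidableEq α] (n k : ℕ)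
    (hn : 1 ≤ n) (hk : 1 ≤ k)
    (B : Finset α) (hB : B.card = k)
    (T : Fin n → Finset α) (hTB : ∀ i : Fin n, T i ⊆ B)
    (hall : ∀ S : Finset (Fin n), S.card ≤ k → S.card ≤ (S.biUnion T).card)
    (x : α) (hx : x ∉ B)
    (T' : Fin n → Finset α) (hT' : ∀ i : Fin n, T' i = T i ∪ {x}) :
    ∀ S : Finset (Fin n), S.card ≤ k + 1 → S.card ≤ (S.biUnion T').card := by
  intro S hS
  rcases S.eq_empty_or_nonempty with rfl | ⟨a, ha⟩
  · simp
  have hcard : (S.erase a).card + 1 = S.card := Finset.card_erase_add_one ha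
  have h1 := hall (S.erase a) (by omega)
  have hxn : x ∉ (S.erase a).biUnion T := by
    intro h
    obtain ⟨i, _, hi⟩ := Finset.mem_biUnion.1 h
    exact hx (hTB i hi)
  have hsub : insert x ((S.erase a).biUnion T) ⊆ S.biUnion T' := by
    intro y hy
    rcases Finset.mem_insert.1 hy with rfl | hy
    · exact Finset.mem_biUnion.2 ⟨a, ha, by simp [hT']⟩
    · obtain ⟨i, hi, hyi⟩ := Finset.mem_biUnion.1 hy
      exact Finset.mem_biUnion.2 ⟨i, Finset.mem_of_mem_erase hi, by simp [hT', hyi]⟩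
  have h2 := Finset.card_le_card hsub
  rw [Finset.card_insert_of_notMem hxn] at h2
  omega
end

section
/- Fix integers s ≥ 1 and k ≥ s with k + 1 ≤ n = k + s; set ω = ⌈k(s+1)/n⌉. For 0 ≤ i < n define T_i ⊆ ℤ/kℤ by T_i = {(i + t) mod k : 0 ≤ t ≤ ω−1} if 0 ≤ i < k, and T_i = {(iω + t) mod k : 0 ≤ t ≤ ω−1} if k ≤ i < n, and define the augmented set T'_i = T_i ∪ {⋆} ⊆ (ℤ/kℤ) ∪ {⋆}, where ⋆ is a new symbol not in ℤ/kℤ. Then for every subset W ⊆ {0, 1, …, n−1} with |W| = k + 1, there exists an injective function f : W → (ℤ/kℤ) ∪ {⋆} such that f(i) ∈ T'_i for every i ∈ W. -/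
lemma alg1_count (s k ω : ℕ) [NeZero k] (h1 : 1 ≤ ω) (h2 : ω ≤ k) (h3 : ω ≤ s + 1)
    (h4 : k * (s + 1) ≤ ω * (k + s)) (B S : Finset (ZMod k)) (hB : B ≠ Finset.univ)
    (hS : ∀ x, x ∈ S ↔ ∀ t < ω, x + (t : ZMod k) ∈ B) :
    S.card + ((Finset.range s).filter (fun j => ((j * ω : ℕ) : ZMod k) ∈ S)).card ≤ B.card := by
  classical
  have hSB : S ⊆ B := fun x hx => by simpa using (hS x).1 hx 0 (by omega)
  rcases S.eq_empty_or_nonempty with rfl | ⟨x0, hx0⟩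
  · simp
  obtain ⟨b, hb⟩ : ∃ b, b ∉ B := by
    by_contra h
    push Not at h
    exact hB (Finset.eq_univ_iff_forall.2 h)
  obtain ⟨e, he, he1⟩ : ∃ e, e ∈ S ∧ e + 1 ∉ S := by
    by_contra h
    push Not at h
    have hall : ∀ m : ℕ, x0 + (m : ZMod k) ∈ S := by
      intro m
      induction m with
      | zero => simpa using hx0
      | succ m ih => simpa [add_assoc] using h _ ih
    have := hall (b - x0).val
    rw [ZMod.natCast_zmod_val] at this
    exact hb (hSB (by simpa using this))
  have heB := (hS e).1 he
  have heω : e + (ω : ZMod k) ∉ B := by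
    intro h
    apply he1
    rw [hS]
    intro t ht
    rcases Nat.lt_or_ge (t + 1) ω with h' | h'
    · have := heB (t + 1) h'
      push_cast at this
      rwa [add_assoc, add_comm 1]
    · have : ω = t + 1 := by omega
      rw [this] at h
      push_cast at h
      rwa [add_assoc, add_comm 1]
  have hdisj : ∀ u < ω, e + (ω : ZMod k) - (u : ZMod k) ∉ S := by
    intro u hu h
    have := (hS _).1 h u hu
    exact heω (by simpa using this)
  -- elements of B outside S
  have c1 : S.card + (ω - 1) ≤ B.card := by
    have hinj : Set.InjOn (fun t : ℕ => e + (ω : ZMod k) - ((t + 1 : ℕ) : ZMod k))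
        (Finset.range (ω - 1)) := by
      intro a ha b hb hab
      simp only [Finset.coe_range, Set.mem_Iio] at ha hb
      have := sub_right_injective hab
      rw [ZMod.natCast_eq_natCast_iff] at this
      have := Nat.ModEq.eq_of_lt_of_lt this (by omega) (by omega)
      omega
    rw [← Finset.card_range (ω - 1), ← Finset.card_image_of_injOn hinj,
      ← Finset.card_union_of_disjoint]
    · apply Finset.card_le_card
      apply Finset.union_subset hSB
      intro x hx
      obtain ⟨t, ht, rfl⟩ := Finset.mem_image.1 hx
      rw [Finset.mem_range] at ht
      have := heB (ω - (t + 1)) (by omega)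
      rw [Nat.cast_sub (by omega)] at this
      rwa [← add_sub_assoc] at this
    · rw [Finset.disjoint_right]
      intro x hx
      obtain ⟨t, ht, rfl⟩ := Finset.mem_image.1 hx
      rw [Finset.mem_range] at ht
      exact hdisj (t + 1) (by omega)
  have c2 : ((Finset.range s).filter (fun j => ((j * ω : ℕ) : ZMod k) ∈ S)).card
      + (s + 1 - ω) ≤ s := by
    set y := (e + (ω : ZMod k)).val with hy
    have hyk : y < k := ZMod.val_lt _
    have hyc : (y : ZMod k) = e + (ω : ZMod k) := by rw [hy, ZMod.natCast_zmod_val]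
    have hinj : Set.InjOn (fun c : ℕ => (y + c * k) / ω) (Finset.range (s + 1 - ω)) := by
      have key : ∀ a b : ℕ, a < b → (y + a * k) / ω < (y + b * k) / ω := by
        intro a b hab
        have : y + a * k + ω ≤ y + b * k := by nlinarith
        calc (y + a * k) / ω < (y + a * k) / ω + 1 := Nat.lt_succ_self _
          _ = (y + a * k + ω) / ω := (Nat.add_div_right _ (by omega)).symm
          _ ≤ _ := Nat.div_le_div_right this
      have : StrictMono (fun c : ℕ => (y + c * k) / ω) := fun a b h => key a b h
      exact this.injective.injOn
    conv_lhs => rw [← Finset.card_range (s + 1 - ω)]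
    conv_rhs => rw [← Finset.card_range s]
    rw [← Finset.card_image_of_injOn hinj, ← Finset.card_union_of_disjoint]
    · apply Finset.card_le_card
      apply Finset.union_subset (Finset.filter_subset _ _)
      intro x hx
      obtain ⟨c, hc, rfl⟩ := Finset.mem_image.1 hx
      rw [Finset.mem_range] at hc ⊢
      rw [Nat.div_lt_iff_lt_mul (by omega)]
      have h5 : (c + 1) * k + ω * k ≤ (s + 1) * k := by
        rw [← add_mul]
        exact Nat.mul_le_mul_right _ (by omega)
      nlinarith
    · rw [Finset.disjoint_right]
      intro x hx
      obtain ⟨c, hc, rfl⟩ := Finset.mem_image.1 hx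
      simp only [Finset.mem_filter, not_and]
      intro _
      have hm := Nat.mod_lt (y + c * k) (show ω > 0 by omega)
      have hd := Nat.div_add_mod' (y + c * k) ω
      have h6 := hdisj _ hm
      have h7 : (((y + c * k) / ω * ω : ℕ) : ZMod k)
          = e + (ω : ZMod k) - (((y + c * k) % ω : ℕ) : ZMod k) := by
        rw [eq_sub_iff_add_eq, ← Nat.cast_add, hd]
        simp [hyc]
      rwa [h7]
  omega

/-- in the private scheme (Algorithm 2), augmenting each Algorithm-1
support set by a common new symbol `⋆` (here `Option.none`, with `ℤ/kℤ` embedded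
via `Option.some`), any `k+1` workers admit a perfect matching to the `k+1`
unknowns. -/
theorem alg2_perfect_matching (s k n ω : ℕ) (hs : 1 ≤ s) (hsk : s ≤ k)
    (hn : n = k + s) (hkn : k + 1 ≤ n)
    (hω : (ω : ℤ) = ⌈((k : ℚ) * (s + 1)) / n⌉)
    (T : Fin n → Finset (ZMod k))
    (hT : ∀ i : Fin n, T i =
      if (i : ℕ) < k then
        (Finset.range ω).image (fun t => (((i : ℕ) + t : ℕ) : ZMod k))
      else
        (Finset.range ω).image (fun t => (((i : ℕ) * ω + t : ℕ) : ZMod k)))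
    (T' : Fin n → Finset (Option (ZMod k)))
    (hT' : ∀ i : Fin n, T' i = (T i).image Option.some ∪ {(none : Option (ZMod k))})
    (W : Finset (Fin n)) (hW : W.card = k + 1) :
    ∃ f : W → Option (ZMod k), Function.Injective f ∧ ∀ i : W, f i ∈ T' (i : Fin n) := by
  classical
  have hk : 1 ≤ k := hs.trans hsk
  haveI : NeZero k := ⟨by omega⟩
  have hnpos : (0 : ℚ) < n := by exact_mod_cast (by omega : 0 < n)
  have hup : ∀ m : ℕ, k * (s + 1) ≤ m * n → ω ≤ m := by
    intro m hm
    have : (ω : ℤ) ≤ (m : ℤ) := by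
      rw [hω, Int.ceil_le, div_le_iff₀ hnpos]
      exact_mod_cast hm
    exact_mod_cast this
  have h4 : k * (s + 1) ≤ ω * (k + s) := by
    have := Int.le_ceil (((k : ℚ) * (s + 1)) / n)
    rw [← hω, div_le_iff₀ hnpos] at this
    rw [← hn]
    exact_mod_cast this
  have h1 : 1 ≤ ω := by
    by_contra h
    have : ω = 0 := by omega
    subst this
    nlinarith
  have h2 : ω ≤ k := hup k (by subst hn; nlinarith)
  have h3 : ω ≤ s + 1 := hup (s + 1) (by subst hn; nlinarith)
  have main : ∀ (U : Finset (Fin n)) (B : Finset (ZMod k)), B ≠ Finset.univ →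
      (∀ i ∈ U, T i ⊆ B) → U.card ≤ B.card := by
    intro U B hB hU
    set S : Finset (ZMod k) :=
      Finset.univ.filter (fun x => ∀ t < ω, x + (t : ZMod k) ∈ B) with hSdef
    have hS : ∀ x, x ∈ S ↔ ∀ t < ω, x + (t : ZMod k) ∈ B := by simp [hSdef]
    refine le_trans ?_ (alg1_count s k ω h1 h2 h3 h4 B S hB hS)
    rw [← Finset.card_filter_add_card_filter_not (s := U) (fun i : Fin n => (i : ℕ) < k)]
    apply add_le_add
    · apply Finset.card_le_card_of_injOn (fun i : Fin n => ((i : ℕ) : ZMod k))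
      · intro i hi
        have hi := Finset.mem_filter.1 hi
        refine (hS _).2 ?_
        intro t ht
        apply hU i hi.1
        rw [hT, if_pos hi.2]
        exact Finset.mem_image.2 ⟨t, Finset.mem_range.2 ht, by push_cast; rfl⟩
      · intro a ha b hb hab
        have ha := (Finset.mem_filter.1 ha).2
        have hb := (Finset.mem_filter.1 hb).2
        have hab := (ZMod.natCast_eq_natCast_iff _ _ _).1 hab
        exact Fin.ext (Nat.ModEq.eq_of_lt_of_lt hab ha hb)
    · apply Finset.card_le_card_of_injOn (fun i : Fin n => (i : ℕ) - k)
      · intro i hi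
        have hi := Finset.mem_filter.1 hi
        have hin := i.2
        refine Finset.mem_filter.2 ⟨Finset.mem_range.2 (by show (i : ℕ) - k < s; omega), (hS _).2 ?_⟩
        intro t ht
        apply hU i hi.1
        rw [hT, if_neg hi.2]
        refine Finset.mem_image.2 ⟨t, Finset.mem_range.2 ht, ?_⟩
        push_cast [Nat.cast_sub (not_lt.1 hi.2)]
        simp
      · intro a ha b hb hab
        have ha := (Finset.mem_filter.1 ha).2
        have hb := (Finset.mem_filter.1 hb).2
        apply Fin.ext
        simp only at hab
        omega
  apply (Finset.all_card_le_biUnion_card_iff_exists_injective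
    (fun i : W => T' (i : Fin n))).1
  intro U
  rcases U.eq_empty_or_nonempty with rfl | hne
  · simp
  set B : Finset (ZMod k) := U.biUnion (fun i => T (i : Fin n)) with hBdef
  have hUn : U.biUnion (fun i : W => T' (i : Fin n)) = insert none (B.image Option.some) := by
    obtain ⟨u, hu⟩ := hne
    ext x
    cases x with
    | none =>
      simp only [Finset.mem_biUnion, Finset.mem_insert, true_or, iff_true]
      exact ⟨u, hu, by simp [hT']⟩
    | some x => simp [hT', hBdef]
  rw [hUn, Finset.card_insert_of_notMem (by simp),
    Finset.card_image_of_injective _ (Option.some_injective _)]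
  by_cases hB : B = Finset.univ
  · rw [hB, Finset.card_univ, ZMod.card, ← hW]
    exact (Finset.card_le_univ U).trans (by simp)
  · have := main (U.image Subtype.val) B hB (by
      intro i hi
      obtain ⟨j, hj, rfl⟩ := Finset.mem_image.1 hi
      exact Finset.subset_biUnion_of_mem (fun i : W => T (i : Fin n)) hj)
    rw [Finset.card_image_of_injective _ Subtype.val_injective] at this
    omega
end

section
/- Fix integers s ≥ 1 and k ≥ s with k + 1 ≤ n = k + s; set ω = ⌈k(s+1)/n⌉. For 0 ≤ i < n define T_i ⊆ ℤ/kℤ by T_i = {(i + t) mod k : 0 ≤ t ≤ ω−1} if 0 ≤ i < k, and T_i = {(iω + t) mod k : 0 ≤ t ≤ ω−1} if k ≤ i < n, and define the augmented set T'_i = T_i ∪ {⋆} ⊆ (ℤ/kℤ) ∪ {⋆}, where ⋆ is a new symbol not in ℤ/kℤ. Then for every subset W ⊆ {0, 1, …, n−1} with |W| = k + 1, there exists a real (k+1) × (k+1) matrix H, with rows indexed by W and columns indexed by (ℤ/kℤ) ∪ {⋆}, such that H_{i,j} = 0 whenever j ∉ T'_i and H is invertible (det H ≠ 0). -/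
/-- Growth of unions of cyclic intervals. -/
lemma interval_growth (k : ℕ) [NeZero k] (S : Finset (ZMod k)) (hS : S.Nonempty) (m : ℕ) :
    ∀ U : Finset (ZMod k), U ≠ Finset.univ →
      (∀ x ∈ S, ∀ t : ℕ, t < m + 1 → x + (t : ZMod k) ∈ U) → S.card + m ≤ U.card := by
  induction m with
  | zero =>
    intro U _ h
    have : S ⊆ U := fun x hx => by simpa using h x hx 0 (by omega)
    simpa using Finset.card_le_card this
  | succ m ih =>
    intro U hU h
    -- the elements of `U` whose successor is in `U`
    set V := U.filter (fun x => x + 1 ∈ U) with hV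
    have hVU : V ⊆ U := Finset.filter_subset _ _
    have h1 : ∀ x ∈ S, ∀ t : ℕ, t < m + 1 → x + (t : ZMod k) ∈ V := by
      intro x hx t ht
      rw [hV, Finset.mem_filter]
      refine ⟨h x hx t (by omega), ?_⟩
      have := h x hx (t + 1) (by omega)
      push_cast at this
      rwa [← add_assoc] at this
    have hne : V ≠ U := by
      intro heq
      apply hU
      have hstep : ∀ x ∈ U, x + 1 ∈ U := by
        intro x hx
        rw [← heq, hV, Finset.mem_filter] at hx
        exact hx.2
      obtain ⟨x, hx⟩ := hS
      have hx0 : x ∈ U := by simpa using h x hx 0 (by omega)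
      have hall : ∀ t : ℕ, x + (t : ZMod k) ∈ U := by
        intro t
        induction t with
        | zero => simpa using hx0
        | succ t iht =>
          have := hstep _ iht
          push_cast
          rwa [← add_assoc]
      ext y
      simp only [Finset.mem_univ, iff_true]
      have := hall (y - x).val
      simpa using this
    have hlt : V.card < U.card := Finset.card_lt_card (hVU.ssubset_of_ne hne)
    have hVuniv : V ≠ Finset.univ := by
      intro hh
      apply hU
      rw [Finset.eq_univ_iff_forall] at hh ⊢
      exact fun x => hVU (hh x)
    have := ih V hVuniv h1
    omega

/-- The tail workers avoiding a symbol `j` are few. -/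
lemma tail_card (s k ω : ℕ) [NeZero k] (hω1 : 1 ≤ ω) (hωk : ω ≤ k)
    (hmain : k * (s + 1) ≤ ω * (k + s)) (j : ZMod k) (B : Finset ℕ)
    (hB : ∀ i ∈ B, k ≤ i ∧ i < k + s)
    (hj : ∀ i ∈ B, ∀ t < ω, ((i * ω + t : ℕ) : ZMod k) ≠ j) : B.card + 1 ≤ ω := by
  have hBs : B ⊆ Finset.Ico k (k + s) := fun i hi => by
    simpa using hB i hi
  by_cases hsw : s + 1 ≤ ω
  · have := Finset.card_le_card hBs
    simp at this
    omega
  push Not at hsw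
  obtain ⟨q, hq⟩ : ∃ q, s + 1 = ω + q := ⟨s + 1 - ω, by omega⟩
  have hkq : k * q ≤ s * ω := by nlinarith
  have hjk : j.val < k := ZMod.val_lt j
  set f : ℕ → ℕ := fun r => (j.val + k * (ω + r)) / ω with hf
  have hmono : StrictMono f := by
    apply strictMono_nat_of_lt_succ
    intro r
    have h1 : (j.val + k * (ω + r)) / ω + 1 = (j.val + k * (ω + r) + ω) / ω := by
      rw [Nat.add_div_right _ (by omega)]
    have h2 : (j.val + k * (ω + r) + ω) / ω ≤ (j.val + k * (ω + (r + 1))) / ω :=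
      Nat.div_le_div_right (by nlinarith)
    simp only [hf]
    omega
  have hC : (Finset.range q).image f ⊆ Finset.Ico k (k + s) := by
    intro i hi
    obtain ⟨r, hr, rfl⟩ := Finset.mem_image.1 hi
    rw [Finset.mem_range] at hr
    rw [Finset.mem_Ico]
    constructor
    · rw [hf, Nat.le_div_iff_mul_le (by omega)]
      nlinarith
    · rw [hf, Nat.div_lt_iff_lt_mul (by omega)]
      have : k * (r + 1) ≤ k * q := Nat.mul_le_mul_left _ hr
      nlinarith
  have hdisj : Disjoint B ((Finset.range q).image f) := by
    rw [Finset.disjoint_left]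
    intro i hi hi2
    obtain ⟨r, hr, rfl⟩ := Finset.mem_image.1 hi2
    apply hj _ hi ((j.val + k * (ω + r)) % ω) (Nat.mod_lt _ (by omega))
    simp only [hf]
    rw [Nat.div_add_mod']
    simp
  have h3 := Finset.card_le_card (Finset.union_subset hBs hC)
  rw [Finset.card_union_of_disjoint hdisj, Finset.card_image_of_injective _ hmono.injective] at h3
  simp at h3
  omega

lemma hall_core (s k n ω : ℕ) [NeZero k] (hn : n = k + s) (hω1 : 1 ≤ ω) (hωk : ω ≤ k)
    (hmain : k * (s + 1) ≤ ω * (k + s))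
    (T : Fin n → Finset (ZMod k))
    (hT : ∀ i : Fin n, T i =
      if (i : ℕ) < k then
        (Finset.range ω).image (fun t => (((i : ℕ) + t : ℕ) : ZMod k))
      else
        (Finset.range ω).image (fun t => (((i : ℕ) * ω + t : ℕ) : ZMod k)))
    (Y : Finset (Fin n)) (hY : Y.biUnion T ≠ Finset.univ) : Y.card ≤ (Y.biUnion T).card := by
  set U := Y.biUnion T with hU
  obtain ⟨m, rfl⟩ : ∃ m, ω = m + 1 := ⟨ω - 1, by omega⟩
  set A := Y.filter (fun i : Fin n => (i : ℕ) < k) with hA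
  set B := Y.filter (fun i : Fin n => ¬ (i : ℕ) < k) with hB
  have hcard : A.card + B.card = Y.card := Finset.card_filter_add_card_filter_not _
  have hAmem : ∀ i ∈ A, ∀ t < m + 1, (((i : ℕ) + t : ℕ) : ZMod k) ∈ U := by
    intro i hi t ht
    rw [hA, Finset.mem_filter] at hi
    rw [hU, Finset.mem_biUnion]
    refine ⟨i, hi.1, ?_⟩
    rw [hT, if_pos hi.2]
    exact Finset.mem_image_of_mem _ (Finset.mem_range.2 ht)
  have hBmem : ∀ i ∈ B, ∀ t < m + 1, (((i : ℕ) * (m + 1) + t : ℕ) : ZMod k) ∈ U := by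
    intro i hi t ht
    rw [hB, Finset.mem_filter] at hi
    rw [hU, Finset.mem_biUnion]
    refine ⟨i, hi.1, ?_⟩
    rw [hT, if_neg hi.2]
    exact Finset.mem_image_of_mem (fun t => (((i : ℕ) * (m + 1) + t : ℕ) : ZMod k))
      (Finset.mem_range.2 ht)
  have hBcard : B.card ≤ m := by
    obtain ⟨j, hj⟩ : ∃ j, j ∉ U := by
      by_contra! h
      exact hY (Finset.eq_univ_iff_forall.2 h)
    have := tail_card s k (m + 1) hω1 hωk hmain j (B.map Fin.valEmbedding) (by
      intro i hi
      obtain ⟨i', hi', rfl⟩ := Finset.mem_map.1 hi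
      rw [hB, Finset.mem_filter] at hi'
      have := i'.2
      simp only [Fin.valEmbedding_apply]
      omega) (by
      intro i hi t ht he
      obtain ⟨i', hi', rfl⟩ := Finset.mem_map.1 hi
      exact hj (he ▸ hBmem i' hi' t ht))
    rw [Finset.card_map] at this
    omega
  rcases A.eq_empty_or_nonempty with hAe | hAne
  · rcases B.eq_empty_or_nonempty with hBe | ⟨i, hi⟩
    · rw [hAe, hBe] at hcard
      simp at hcard
      omega
    · have := interval_growth k {(((i : ℕ) * (m + 1) : ℕ) : ZMod k)} (by simp) m U hY (by
        intro x hx t ht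
        rw [Finset.mem_singleton] at hx
        have := hBmem i hi t ht
        rw [Nat.cast_add] at this
        rwa [hx])
      rw [hAe] at hcard
      simp at hcard this
      omega
  · have := interval_growth k (A.image (fun i : Fin n => ((i : ℕ) : ZMod k))) (hAne.image _) m U hY (by
        intro x hx t ht
        obtain ⟨i, hi, rfl⟩ := Finset.mem_image.1 hx
        have := hAmem i hi t ht
        rwa [Nat.cast_add] at this)
    rw [Finset.card_image_of_injOn] at this
    · omega
    · intro a ha b hb hab
      have ha' : (a : ℕ) < k := (Finset.mem_filter.1 ha).2
      have hb' : (b : ℕ) < k := (Finset.mem_filter.1 hb).2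
      have := congrArg ZMod.val hab
      simp only [ZMod.val_natCast, Nat.mod_eq_of_lt ha', Nat.mod_eq_of_lt hb'] at this
      exact Fin.ext this


/-- in the private scheme (Algorithm 2), for any set `W` of `k+1`
workers there is a real decoding matrix `H` (rows indexed by `W`, columns by
`(ℤ/kℤ) ∪ {⋆}`, modeled as `Option (ZMod k)` with `⋆ = none`) supported on the
augmented pattern `T'` that is invertible (nonzero determinant after identifying
rows with columns via a bijection). -/
theorem alg2_invertible_decoding (s k n ω : ℕ) [NeZero k]
    (hs : 1 ≤ s) (hsk : s ≤ k) (hn : n = k + s) (hkn : k + 1 ≤ n)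
    (hω : (ω : ℤ) = ⌈((k : ℚ) * (s + 1)) / n⌉)
    (T : Fin n → Finset (ZMod k))
    (hT : ∀ i : Fin n, T i =
      if (i : ℕ) < k then
        (Finset.range ω).image (fun t => (((i : ℕ) + t : ℕ) : ZMod k))
      else
        (Finset.range ω).image (fun t => (((i : ℕ) * ω + t : ℕ) : ZMod k)))
    (T' : Fin n → Finset (Option (ZMod k)))
    (hT' : ∀ i : Fin n, T' i = (T i).image Option.some ∪ {(none : Option (ZMod k))})
    (W : Finset (Fin n)) (hW : W.card = k + 1) :
    ∃ (H : Matrix W (Option (ZMod k)) ℝ) (e : W ≃ Option (ZMod k)),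
      (∀ (i : W) (j : Option (ZMod k)), j ∉ T' (i : Fin n) → H i j = 0) ∧
      (H.submatrix e.symm id).det ≠ 0 := by
  classical
  have hk : 0 < k := Nat.pos_of_ne_zero (NeZero.ne k)
  have hnQ : (0 : ℚ) < (n : ℚ) := by exact_mod_cast (by omega : 0 < n)
  have hω1 : 1 ≤ ω := by
    have : (0 : ℤ) < (ω : ℤ) := by
      rw [hω, Int.ceil_pos]
      positivity
    omega
  have hωk : ω ≤ k := by
    have : (ω : ℤ) ≤ (k : ℤ) := by
      rw [hω, Int.ceil_le, div_le_iff₀ hnQ, hn]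
      have : (1 : ℚ) ≤ k := by exact_mod_cast hk
      push_cast
      nlinarith
    omega
  have hmain : k * (s + 1) ≤ ω * (k + s) := by
    have h := Int.le_ceil (((k : ℚ) * (s + 1)) / n)
    rw [← hω, div_le_iff₀ hnQ, hn] at h
    exact_mod_cast h
  have hall : ∀ Y : Finset W, Y.card ≤ (Y.biUnion (fun i => T' (i : Fin n))).card := by
    intro Y
    rcases Y.eq_empty_or_nonempty with rfl | hYne
    · simp
    set Z : Finset (Fin n) := Y.map (Function.Embedding.subtype _) with hZ
    have hZc : Z.card = Y.card := Finset.card_map _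
    have hZW : Z.card ≤ k + 1 := by
      rw [hZc, ← hW]
      simpa using Finset.card_le_univ Y
    have heq : Finset.insertNone (Z.biUnion T) ⊆ Y.biUnion (fun i => T' (i : Fin n)) := by
      intro x hx
      rw [Finset.mem_biUnion]
      cases x with
      | none =>
        obtain ⟨i, hi⟩ := hYne
        exact ⟨i, hi, by simp [hT']⟩
      | some x =>
        rw [Finset.some_mem_insertNone, Finset.mem_biUnion] at hx
        obtain ⟨i, hi, hx⟩ := hx
        obtain ⟨i', hi', rfl⟩ := Finset.mem_map.1 hi
        refine ⟨i', hi', ?_⟩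
        rw [hT']
        exact Finset.mem_union_left _ (Finset.mem_image_of_mem _ hx)
    have h1 := Finset.card_le_card heq
    rw [Finset.card_insertNone] at h1
    by_cases hU : Z.biUnion T = Finset.univ
    · rw [hU, Finset.card_univ, ZMod.card] at h1
      omega
    · have := hall_core s k n ω hn hω1 hωk hmain T hT Z hU
      omega
  obtain ⟨f, hf, hfT⟩ := (Finset.all_card_le_biUnion_card_iff_exists_injective _).1 hall
  have hbij : Function.Bijective f := by
    rw [Fintype.bijective_iff_injective_and_card]
    refine ⟨hf, ?_⟩
    simp [hW, ZMod.card]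
  refine ⟨fun i j => if f i = j then 1 else 0, Equiv.ofBijective f hbij, ?_, ?_⟩
  · intro i j hj
    have : f i ≠ j := fun h => hj (h ▸ hfT i)
    simp [this]
  · have : Matrix.submatrix (fun (i : W) (j : Option (ZMod k)) => if f i = j then (1 : ℝ) else 0)
        (Equiv.ofBijective f hbij).symm id = 1 := by
      ext a b
      have : f ((Equiv.ofBijective f hbij).symm a) = a :=
        (Equiv.ofBijective f hbij).apply_symm_apply a
      change (if f ((Equiv.ofBijective f hbij).symm a) = b then (1 : ℝ) else 0) = _
      rw [this, Matrix.one_apply]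
    intro h0
    erw [this] at h0
    simp at h0
end
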